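/- arXiv:2306.10221 — 2 statements merged into one kernel-verified Lean document; each statement's English description precedes it below -/
import Mathlib

section
/- Let (Ω, ℱ, P) be a probability space and X, Y : Ω → ℝ random variables such that the law of the pair (X,Y) on ℝ × ℝ under P is a Gaussian measure, and suppose Var(X) > 0. Then the conditional expectation of Y given the σ-algebra generated by X satisfies, P-almost surely, E[Y | σ(X)] = E[Y] + (Cov(X,Y)/Var(X))·(X − E[X]). -/
open MeasureTheory ProbabilityTheory

/-- A measure on `ℝ × ℝ` is Gaussian if every linear functional pushes it forward to a
one-dimensional Gaussian measure. -/
def IsGaussianPair (ν : Measure (ℝ × ℝ)) : Prop :=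
  ∀ a b : ℝ, ∃ (m : ℝ) (v : NNReal),
    ν.map (fun p => a * p.1 + b * p.2) = gaussianReal m v

/-- The covariance `Cov(X, Y) = E[(X − E X)(Y − E Y)]` of two real random variables. -/
noncomputable def cov {Ω : Type*} [MeasurableSpace Ω] (X Y : Ω → ℝ) (P : Measure Ω) : ℝ :=
  ∫ ω, (X ω - ∫ ω', X ω' ∂P) * (Y ω - ∫ ω', Y ω' ∂P) ∂P

/-- A measure on `ℝ × ℝ` that is Gaussian along every linear functional is Gaussian. -/
theorem IsGaussianPair.isGaussian {ν : Measure (ℝ × ℝ)} (h : IsGaussianPair ν) :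
    IsGaussian ν := by
  refine isGaussian_of_map_eq_gaussianReal fun L => ?_
  have hL : (L : ℝ × ℝ → ℝ) = fun p => L (1, 0) * p.1 + L (0, 1) * p.2 := by
    ext p
    have hp : p = p.1 • ((1 : ℝ), (0 : ℝ)) + p.2 • ((0 : ℝ), (1 : ℝ)) := by ext <;> simp
    conv_lhs => rw [hp]
    rw [map_add, map_smul, map_smul, smul_eq_mul, smul_eq_mul]
    ring
  rw [hL]
  exact h _ _

/-- The regression residual `Y - c X`, with `c = Cov(X, Y) / Var(X)`, of a jointly Gaussian pair
is independent of `X`. -/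
theorem ProbabilityTheory.HasGaussianLaw.indepFun_sub_regression {Ω : Type*} [MeasurableSpace Ω]
    {P : Measure Ω} {X Y : Ω → ℝ} (h : HasGaussianLaw (fun ω => (X ω, Y ω)) P)
    (hVar : variance X P ≠ 0) :
    IndepFun X (fun ω => Y ω - cov[X, Y; P] / variance X P * X ω) P := by
  have := h.isProbabilityMeasure
  set c := cov[X, Y; P] / variance X P with hc
  have hpair : HasGaussianLaw (fun ω => (X ω, Y ω - c * X ω)) P := by
    simpa using h.map_fun ((ContinuousLinearMap.fst ℝ ℝ ℝ).prod
      (ContinuousLinearMap.snd ℝ ℝ ℝ - c • ContinuousLinearMap.fst ℝ ℝ ℝ))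
  refine hpair.indepFun_of_covariance_eq_zero ?_
  rw [covariance_fun_sub_right h.fst.memLp_two h.snd.memLp_two (h.fst.memLp_two.const_mul c),
    covariance_const_mul_right, covariance_self h.fst.aemeasurable, hc, div_mul_cancel₀ _ hVar,
    sub_self]

/-- For jointly Gaussian real random variables `(X, Y)` with `Var(X) > 0`,
the conditional expectation of `Y` given `σ(X)` is
`E[Y] + (Cov(X,Y)/Var(X))·(X − E[X])` almost surely. -/
theorem condexp_of_gaussian_pair {Ω : Type*} [MeasurableSpace Ω]
    (P : Measure Ω) [IsProbabilityMeasure P]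
    (X Y : Ω → ℝ) (hX : Measurable X) (hY : Measurable Y)
    (hGauss : IsGaussianPair (P.map fun ω => (X ω, Y ω)))
    (hVar : 0 < variance X P) :
    ∀ᵐ ω ∂P,
      (P[Y | MeasurableSpace.comap X inferInstance]) ω =
        (∫ ω', Y ω' ∂P) + cov X Y P / variance X P * (X ω - ∫ ω', X ω' ∂P) := by
  have := hGauss.isGaussian
  have h : HasGaussianLaw (fun ω => (X ω, Y ω)) P := ⟨this⟩
  have hXi := h.fst.integrable
  have hYi := h.snd.integrable
  have hcov : cov X Y P = cov[X, Y; P] := rfl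
  rw [hcov]
  have hind := h.indepFun_sub_regression hVar.ne'
  set c := cov[X, Y; P] / variance X P
  let Z : Ω → ℝ := fun ω => Y ω - c * X ω
  have hZ : Measurable Z := by fun_prop
  have hcXi : Integrable (fun ω => c * X ω) P := hXi.const_mul c
  have hZi : Integrable Z P := hYi.sub hcXi
  have hXm : MeasurableSpace.comap X inferInstance ≤ ‹MeasurableSpace Ω› := hX.comap_le
  have hcondX : P[fun ω => c * X ω | MeasurableSpace.comap X inferInstance] = fun ω => c * X ω :=
    condExp_of_stronglyMeasurable hXm
      ((comap_measurable X).const_mul c).stronglyMeasurable hcXi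
  have hcondZ : P[Z | MeasurableSpace.comap X inferInstance] =ᵐ[P] fun _ => ∫ ω, Z ω ∂P :=
    condExp_indep_eq hZ.comap_le hXm (comap_measurable Z).stronglyMeasurable
      ((IndepFun_iff_Indep _ _ _).1 hind.symm)
  have hsum : Y = Z + fun ω => c * X ω := by
    ext ω
    simp [Z]
  have hadd := condExp_add hZi hcXi (MeasurableSpace.comap X inferInstance)
  rw [← hsum, hcondX] at hadd
  filter_upwards [hadd, hcondZ] with ω h1 h2
  rw [h1, Pi.add_apply, h2, integral_sub hYi hcXi, integral_const_mul]
  ring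
end

section
/- Let (Ω, ℱ, P) be a probability space and X, Y : Ω → ℝ random variables such that the law of the pair (X,Y) on ℝ × ℝ under P is a Gaussian measure, and suppose Var(X) > 0. Then the conditional variance of Y given σ(X) is the constant Var(Y) − Cov(X,Y)²/Var(X); that is, P-almost surely, E[(Y − E[Y|σ(X)])² | σ(X)] = Var(Y) − Cov(X,Y)²/Var(X). -/
open MeasureTheory ProbabilityTheory

theorem cov_eq_covariance {Ω : Type*} [MeasurableSpace Ω] (X Y : Ω → ℝ) (P : Measure Ω) :
    cov X Y P = covariance X Y P := rfl

/-- Subtracting the regression of `Y` on `X` leaves a variable uncorrelated with `X`. -/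
theorem covariance_regression_residual {Ω : Type*} [MeasurableSpace Ω] {P : Measure Ω}
    [IsFiniteMeasure P] {X Y : Ω → ℝ} (hX : MemLp X 2 P) (hY : MemLp Y 2 P)
    (hVar : variance X P ≠ 0) :
    covariance (Y - (covariance X Y P / variance X P) • X) X P = 0 := by
  rw [covariance_sub_left hY (hX.const_smul _) hX, covariance_smul_left,
    covariance_self hX.aemeasurable, covariance_comm Y X, div_mul_cancel₀ _ hVar, sub_self]

theorem variance_regression_residual {Ω : Type*} [MeasurableSpace Ω] {P : Measure Ω}
    [IsFiniteMeasure P] {X Y : Ω → ℝ} (hX : MemLp X 2 P) (hY : MemLp Y 2 P)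
    (hVar : variance X P ≠ 0) :
    variance (Y - (covariance X Y P / variance X P) • X) P =
      variance Y P - covariance X Y P ^ 2 / variance X P := by
  rw [variance_sub hY (hX.const_smul _), variance_smul, covariance_smul_right,
    covariance_comm Y X]
  field_simp
  ring

/-- The residual of the regression of `Y` on `X` is independent of `X`. -/
theorem indepFun_regression_residual {Ω : Type*} [MeasurableSpace Ω] {P : Measure Ω}
    [IsFiniteMeasure P] {X Y : Ω → ℝ} (hXY : HasGaussianLaw (fun ω ↦ (X ω, Y ω)) P)
    (hVar : variance X P ≠ 0) :
    IndepFun (Y - (covariance X Y P / variance X P) • X) X P := by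
  set c := covariance X Y P / variance X P with hc
  have hlaw : HasGaussianLaw (fun ω ↦ ((Y - c • X) ω, X ω)) P :=
    hXY.map ((ContinuousLinearMap.snd ℝ ℝ ℝ - c • ContinuousLinearMap.fst ℝ ℝ ℝ).prod
      (ContinuousLinearMap.fst ℝ ℝ ℝ))
  exact hlaw.indepFun_of_covariance_eq_zero
    (covariance_regression_residual hXY.fst.memLp_two hXY.snd.memLp_two hVar)

/-- If `Y - f` is independent of a sub-σ-algebra for which `f` is measurable, the conditional
variance of `Y` is almost surely the variance of `Y - f`. -/
theorem condVar_ae_eq_variance_of_indep_sub {Ω : Type*} {m m₀ : MeasurableSpace Ω}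
    {P : Measure Ω} [IsProbabilityMeasure P] (hm : m ≤ m₀) {Y f : Ω → ℝ}
    (hY : Measurable Y) (hYi : Integrable Y P) (hf : StronglyMeasurable[m] f)
    (hfi : Integrable f P)
    (hindep : Indep (MeasurableSpace.comap (Y - f) inferInstance) m P) :
    P[(fun ω ↦ (Y ω - (P[Y | m]) ω) ^ 2) | m] =ᵐ[P] fun _ ↦ variance (Y - f) P := by
  have hZ : Measurable (Y - f) := hY.sub (hf.measurable.mono hm le_rfl)
  have hZ' : Measurable[MeasurableSpace.comap (Y - f) inferInstance] (Y - f) :=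
    comap_measurable _
  have hcond : P[Y - f | m] =ᵐ[P] fun _ ↦ P[Y - f] :=
    condExp_indep_eq hZ.comap_le hm hZ'.stronglyMeasurable hindep
  have hres : (fun ω ↦ (Y ω - (P[Y | m]) ω) ^ 2) =ᵐ[P]
      fun ω ↦ ((Y - f) ω - P[Y - f]) ^ 2 := by
    filter_upwards [hcond, condExp_sub hYi hfi m] with ω h₁ h₂
    rw [h₁, Pi.sub_apply, condExp_of_stronglyMeasurable hm hf hfi] at h₂
    rw [h₂, Pi.sub_apply]
    ring
  refine (condExp_congr_ae hres).trans ?_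
  rw [variance_eq_integral hZ.aemeasurable]
  exact condExp_indep_eq hZ.comap_le hm
    ((hZ'.sub_const _).pow_const 2).stronglyMeasurable hindep

/-- For jointly Gaussian real random variables `(X, Y)` with `Var(X) > 0`,
the conditional variance of `Y` given `σ(X)` is the constant
`Var(Y) − Cov(X,Y)²/Var(X)`, i.e. almost surely
`E[(Y − E[Y|σ(X)])² | σ(X)] = Var(Y) − Cov(X,Y)²/Var(X)`. -/
theorem condVar_of_gaussian_pair {Ω : Type*} [MeasurableSpace Ω]
    (P : Measure Ω) [IsProbabilityMeasure P]
    (X Y : Ω → ℝ) (hX : Measurable X) (hY : Measurable Y)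
    (hGauss : IsGaussianPair (P.map fun ω => (X ω, Y ω)))
    (hVar : 0 < variance X P) :
    ∀ᵐ ω ∂P,
      (P[(fun ω' => (Y ω' - (P[Y | MeasurableSpace.comap X inferInstance]) ω') ^ 2) |
          MeasurableSpace.comap X inferInstance]) ω =
        variance Y P - (cov X Y P) ^ 2 / variance X P := by
  have hXY : HasGaussianLaw (fun ω ↦ (X ω, Y ω)) P := ⟨hGauss.isGaussian⟩
  rw [cov_eq_covariance,
    ← variance_regression_residual hXY.fst.memLp_two hXY.snd.memLp_two hVar.ne']
  exact condVar_ae_eq_variance_of_indep_sub hX.comap_le hY hXY.snd.integrable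
    ((comap_measurable X).const_smul _).stronglyMeasurable (hXY.fst.integrable.smul _)
    ((IndepFun_iff_Indep _ _ _).1 (indepFun_regression_residual hXY hVar.ne'))
end
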